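/- arXiv:2309.07830 — 2 statements merged into one kernel-verified Lean document; each statement's English description precedes it below -/
import Mathlib

section
/- The 3-eigenspace Λ²₇ of the operator T (i.e. of ω ↦ ⋆(Φ₀∧ω)) is exactly the set of cross-product forms: {ω alternating 2-form on ℝ⁸ : Tω = 3ω} = { u♭∧v♭ − ι(u)ι(v)Φ₀ : u,v ∈ ℝ⁸ }, where u♭∧v♭ − ι(u)ι(v)Φ₀ denotes the alternating 2-form (x,y) ↦ ⟨u,x⟩⟨v,y⟩ − ⟨u,y⟩⟨v,x⟩ + Φ₀(u,v,x,y). In particular every form 4(u×v) lies in Λ²₇, and every element of Λ²₇ is of this form. -/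
open scoped BigOperators RealInnerProductSpace

noncomputable section

/-- ℝ⁸ with its Euclidean inner product. -/
abbrev V8 : Type := EuclideanSpace ℝ (Fin 8)

/-- The standard orthonormal basis vectors e₁, …, e₈ of ℝ⁸ (indexed by `Fin 8`). -/
def e (i : Fin 8) : V8 := EuclideanSpace.single i (1 : ℝ)

/-- The alternating 4-form `dxᵢ ∧ dxⱼ ∧ dx_k ∧ dx_l` on ℝ⁸. -/
def dxQ (i j k l : Fin 8) : AlternatingMap ℝ V8 ℝ (Fin 4) :=
  (Matrix.detRowAlternating : AlternatingMap ℝ (Fin 4 → ℝ) ℝ (Fin 4)).compLinearMap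
    (LinearMap.pi fun a : Fin 4 =>
      ((EuclideanSpace.proj (![i, j, k, l] a) : V8 →L[ℝ] ℝ) : V8 →ₗ[ℝ] ℝ))

/-- The standard Cayley form Φ₀ on ℝ⁸. -/
def Phi0 : AlternatingMap ℝ V8 ℝ (Fin 4) :=
  dxQ 0 1 2 3 - dxQ 0 1 4 5 - dxQ 0 1 6 7 - dxQ 0 2 4 6 + dxQ 0 2 5 7 -
    dxQ 0 3 4 7 - dxQ 0 3 5 6 - dxQ 1 2 4 7 - dxQ 1 2 5 6 + dxQ 1 3 4 6 -
    dxQ 1 3 5 7 - dxQ 2 3 4 5 - dxQ 2 3 6 7 + dxQ 4 5 6 7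

/-- Evaluation of an alternating 2-form at a fixed pair of vectors, as a linear functional. -/
def evalSM (v : Fin 2 → V8) : AlternatingMap ℝ V8 ℝ (Fin 2) →ₗ[ℝ] ℝ where
  toFun ω := ω v
  map_add' _ _ := rfl
  map_smul' _ _ := rfl

/-- The alternating 2-form `(x, y) ↦ Φ₀(u, v, x, y)`. -/
def iotaPhi (u v : V8) : AlternatingMap ℝ V8 ℝ (Fin 2) :=
  (Phi0.curryLeft u).curryLeft v

/-- The operator `T : ω ↦ ⋆(Φ₀ ∧ ω)` on alternating 2-forms, given by
`(Tω)(x,y) = Σ_{i<j} ω(eᵢ,eⱼ) Φ₀(eᵢ,eⱼ,x,y)`. -/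
def T : AlternatingMap ℝ V8 ℝ (Fin 2) →ₗ[ℝ] AlternatingMap ℝ V8 ℝ (Fin 2) :=
  ∑ i : Fin 8, ∑ j : Fin 8,
    if i < j then (evalSM ![e i, e j]).smulRight (iotaPhi (e i) (e j)) else 0

/-- The wedge `u♭ ∧ v♭`, i.e. the alternating 2-form `(x,y) ↦ ⟨u,x⟩⟨v,y⟩ − ⟨u,y⟩⟨v,x⟩`. -/
def wedgeF (u v : V8) : AlternatingMap ℝ V8 ℝ (Fin 2) :=
  (Matrix.detRowAlternating : AlternatingMap ℝ (Fin 2 → ℝ) ℝ (Fin 2)).compLinearMap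
    (LinearMap.pi fun a : Fin 2 =>
      ((![innerSL ℝ u, innerSL ℝ v] a : V8 →L[ℝ] ℝ) : V8 →ₗ[ℝ] ℝ))

/-- The alternating 2-form `u♭∧v♭ − ι(u)ι(v)Φ₀ : (x,y) ↦ ⟨u,x⟩⟨v,y⟩ − ⟨u,y⟩⟨v,x⟩ + Φ₀(u,v,x,y)`,
which equals `4(u×v)`. -/
def crossForm7 (u v : V8) : AlternatingMap ℝ V8 ℝ (Fin 2) :=
  wedgeF u v + iotaPhi u v

/-- The `2 × 2` minor `dx_p ∧ dx_q (x, y)`. -/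
def minor (p q : Fin 8) (x y : V8) : ℝ := x p * y q - x q * y p

theorem e_apply (i j : Fin 8) : e i j = if j = i then 1 else 0 := by
  simp [e]

theorem dxQ_apply (p q r s : Fin 8) (a b x y : V8) :
    dxQ p q r s ![a, b, x, y] =
      minor p q a b * minor r s x y - minor p r a b * minor q s x y +
        minor p s a b * minor q r x y + minor q r a b * minor p s x y -
        minor q s a b * minor p r x y + minor r s a b * minor p q x y := by
  have h : dxQ p q r s ![a, b, x, y] = Matrix.det
      !![a p, a q, a r, a s; b p, b q, b r, b s; x p, x q, x r, x s; y p, y q, y r, y s] := by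
    change Matrix.det (_ : Matrix (Fin 4) (Fin 4) ℝ) = _
    congr 1
    ext i j
    fin_cases i <;> fin_cases j <;> rfl
  rw [h]
  simp [Matrix.det_succ_row_zero, Fin.sum_univ_succ, Fin.succAbove, minor]
  ring

theorem map_swap_pair (ω : AlternatingMap ℝ V8 ℝ (Fin 2)) (x y : V8) :
    ω ![y, x] = -ω ![x, y] := by
  have h := ω.map_swap ![x, y] (show (0 : Fin 2) ≠ 1 by decide)
  rw [← h]
  congr 1
  ext i : 1
  fin_cases i <;> simp

theorem map_self_pair (ω : AlternatingMap ℝ V8 ℝ (Fin 2)) (x : V8) : ω ![x, x] = 0 :=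
  ω.map_eq_zero_of_eq ![x, x] (i := 0) (j := 1) rfl (by decide)

theorem alternating_two_ext {ω η : AlternatingMap ℝ V8 ℝ (Fin 2)}
    (h : ∀ i j : Fin 8, i < j → ω ![e i, e j] = η ![e i, e j]) : ω = η := by
  refine (EuclideanSpace.basisFun (Fin 8) ℝ).toBasis.ext_alternating fun v hv => ?_
  have hv' : (fun i => (EuclideanSpace.basisFun (Fin 8) ℝ).toBasis (v i)) =
      ![e (v 0), e (v 1)] := by
    ext i : 1
    fin_cases i <;> simp [e]
  rw [hv']
  rcases lt_or_gt_of_ne (hv.ne (show (0 : Fin 2) ≠ 1 by decide)) with hlt | hlt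
  · exact h _ _ hlt
  · rw [map_swap_pair, map_swap_pair η, h _ _ hlt]

theorem sum_mul_minor (ω : AlternatingMap ℝ V8 ℝ (Fin 2)) (p q : Fin 8) :
    ∑ i, ∑ j, (if i < j then ω ![e i, e j] * minor p q (e i) (e j) else 0) = ω ![e p, e q] := by
  have h (i j : Fin 8) : (if i < j then ω ![e i, e j] * minor p q (e i) (e j) else 0) =
      (if q = j then if p = i then if p < q then ω ![e p, e q] else 0 else 0 else 0) -
        (if p = j then if q = i then if q < p then ω ![e q, e p] else 0 else 0 else 0) := by
    simp only [minor, e_apply]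
    split_ifs <;> subst_vars <;> simp_all
  simp only [h, Finset.sum_sub_distrib, Finset.sum_ite_eq, Finset.mem_univ, if_true]
  rcases lt_trichotomy p q with hlt | rfl | hlt
  · simp [hlt, hlt.not_gt]
  · simp [map_self_pair]
  · simp [hlt, hlt.not_gt, map_swap_pair ω (e q)]

/-- Contraction of `dx_{pqrs}` with the skew array `m`, evaluated at `(x, y)`. -/
def dxQContract (m : Fin 8 → Fin 8 → ℝ) (p q r s : Fin 8) (x y : V8) : ℝ :=
  m p q * minor r s x y - m p r * minor q s x y + m p s * minor q r x y +
    m q r * minor p s x y - m q s * minor p r x y + m r s * minor p q x y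

/-- Contraction of `Φ₀` with the skew array `m`, evaluated at `(x, y)`. -/
def Phi0Contract (m : Fin 8 → Fin 8 → ℝ) (x y : V8) : ℝ :=
  dxQContract m 0 1 2 3 x y - dxQContract m 0 1 4 5 x y - dxQContract m 0 1 6 7 x y -
    dxQContract m 0 2 4 6 x y + dxQContract m 0 2 5 7 x y - dxQContract m 0 3 4 7 x y -
    dxQContract m 0 3 5 6 x y - dxQContract m 1 2 4 7 x y - dxQContract m 1 2 5 6 x y +
    dxQContract m 1 3 4 6 x y - dxQContract m 1 3 5 7 x y - dxQContract m 2 3 4 5 x y -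
    dxQContract m 2 3 6 7 x y + dxQContract m 4 5 6 7 x y

theorem Phi0_apply (u v x y : V8) :
    Phi0 ![u, v, x, y] = Phi0Contract (fun p q => minor p q u v) x y := by
  simp only [Phi0, AlternatingMap.add_apply, AlternatingMap.sub_apply, dxQ_apply, Phi0Contract,
    dxQContract]

theorem sum_mul_dxQ (ω : AlternatingMap ℝ V8 ℝ (Fin 2)) (p q r s : Fin 8) (x y : V8) :
    ∑ i, ∑ j, (if i < j then ω ![e i, e j] * dxQ p q r s ![e i, e j, x, y] else 0) =
      dxQContract (fun i j => ω ![e i, e j]) p q r s x y := by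
  rw [dxQContract, ← sum_mul_minor ω p q, ← sum_mul_minor ω p r, ← sum_mul_minor ω p s,
    ← sum_mul_minor ω q r, ← sum_mul_minor ω q s, ← sum_mul_minor ω r s]
  simp only [Finset.sum_mul, ← Finset.sum_add_distrib, ← Finset.sum_sub_distrib]
  refine Finset.sum_congr rfl fun i _ => Finset.sum_congr rfl fun j _ => ?_
  split_ifs
  · rw [dxQ_apply]; ring
  · ring

theorem iotaPhi_apply (u v x y : V8) : iotaPhi u v ![x, y] = Phi0 ![u, v, x, y] := by
  simp [iotaPhi]

theorem evalSM_smulRight_apply (v w : Fin 2 → V8) (ω η : AlternatingMap ℝ V8 ℝ (Fin 2)) :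
    evalSM w ((evalSM v).smulRight η ω) = ω v * η w := rfl

theorem T_apply (ω : AlternatingMap ℝ V8 ℝ (Fin 2)) (x y : V8) :
    T ω ![x, y] =
      ∑ i, ∑ j, (if i < j then ω ![e i, e j] * Phi0 ![e i, e j, x, y] else 0) := by
  change evalSM ![x, y] (T ω) = _
  simp only [T, LinearMap.sum_apply, map_sum]
  refine Finset.sum_congr rfl fun i _ => Finset.sum_congr rfl fun j _ => ?_
  split_ifs
  · rw [evalSM_smulRight_apply, iotaPhi_apply]
  · rfl

theorem T_apply_eq_Phi0Contract (ω : AlternatingMap ℝ V8 ℝ (Fin 2)) (x y : V8) :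
    T ω ![x, y] = Phi0Contract (fun i j => ω ![e i, e j]) x y := by
  rw [T_apply]
  simp only [Phi0Contract, ← sum_mul_dxQ, ← Finset.sum_add_distrib, ← Finset.sum_sub_distrib]
  refine Finset.sum_congr rfl fun i _ => Finset.sum_congr rfl fun j _ => ?_
  split_ifs
  · simp only [Phi0, AlternatingMap.add_apply, AlternatingMap.sub_apply]; ring
  · ring

theorem minor_e {p q i j : Fin 8} (hpq : p < q) (hij : i < j) :
    minor p q (e i) (e j) = if p = i ∧ q = j then 1 else 0 := by
  simp only [minor, e_apply]
  split_ifs <;> grind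

set_option maxHeartbeats 2000000 in
theorem Phi0Contract_e (m : Fin 8 → Fin 8 → ℝ) :
    Phi0Contract m (e 0) (e 1) = m 2 3 - m 4 5 - m 6 7 ∧
    Phi0Contract m (e 0) (e 2) = m 5 7 - m 1 3 - m 4 6 ∧
    Phi0Contract m (e 0) (e 3) = m 1 2 - m 4 7 - m 5 6 ∧
    Phi0Contract m (e 0) (e 4) = m 1 5 + m 2 6 + m 3 7 ∧
    Phi0Contract m (e 0) (e 5) = m 3 6 - m 1 4 - m 2 7 ∧
    Phi0Contract m (e 0) (e 6) = m 1 7 - m 2 4 - m 3 5 ∧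
    Phi0Contract m (e 0) (e 7) = m 2 5 - m 1 6 - m 3 4 ∧
    Phi0Contract m (e 1) (e 2) = m 0 3 - m 4 7 - m 5 6 ∧
    Phi0Contract m (e 1) (e 3) = m 4 6 - m 0 2 - m 5 7 ∧
    Phi0Contract m (e 1) (e 4) = m 2 7 - m 0 5 - m 3 6 ∧
    Phi0Contract m (e 1) (e 5) = m 0 4 + m 2 6 + m 3 7 ∧
    Phi0Contract m (e 1) (e 6) = m 3 4 - m 0 7 - m 2 5 ∧
    Phi0Contract m (e 1) (e 7) = m 0 6 - m 2 4 - m 3 5 ∧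
    Phi0Contract m (e 2) (e 3) = m 0 1 - m 4 5 - m 6 7 ∧
    Phi0Contract m (e 2) (e 4) = m 3 5 - m 0 6 - m 1 7 ∧
    Phi0Contract m (e 2) (e 5) = m 0 7 - m 1 6 - m 3 4 ∧
    Phi0Contract m (e 2) (e 6) = m 0 4 + m 1 5 + m 3 7 ∧
    Phi0Contract m (e 2) (e 7) = m 1 4 - m 0 5 - m 3 6 ∧
    Phi0Contract m (e 3) (e 4) = m 1 6 - m 0 7 - m 2 5 ∧
    Phi0Contract m (e 3) (e 5) = m 2 4 - m 0 6 - m 1 7 ∧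
    Phi0Contract m (e 3) (e 6) = m 0 5 - m 1 4 - m 2 7 ∧
    Phi0Contract m (e 3) (e 7) = m 0 4 + m 1 5 + m 2 6 ∧
    Phi0Contract m (e 4) (e 5) = m 6 7 - m 0 1 - m 2 3 ∧
    Phi0Contract m (e 4) (e 6) = m 1 3 - m 0 2 - m 5 7 ∧
    Phi0Contract m (e 4) (e 7) = m 5 6 - m 0 3 - m 1 2 ∧
    Phi0Contract m (e 5) (e 6) = m 4 7 - m 0 3 - m 1 2 ∧
    Phi0Contract m (e 5) (e 7) = m 0 2 - m 1 3 - m 4 6 ∧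
    Phi0Contract m (e 6) (e 7) = m 4 5 - m 0 1 - m 2 3 := by
  refine ⟨?_, ?_, ?_, ?_, ?_, ?_, ?_, ?_, ?_, ?_, ?_, ?_, ?_, ?_, ?_, ?_, ?_, ?_, ?_, ?_, ?_,
    ?_, ?_, ?_, ?_, ?_, ?_, ?_⟩
  all_goals
    simp [Phi0Contract, dxQContract, minor_e]
    try ring

theorem Phi0Contract_add_Phi0Contract (m : Fin 8 → Fin 8 → ℝ) {i j : Fin 8} (hij : i < j) :
    Phi0Contract (fun p q => m p q + Phi0Contract m (e p) (e q)) (e i) (e j) =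
      3 * (m i j + Phi0Contract m (e i) (e j)) := by
  fin_cases i <;> fin_cases j <;> first | exact absurd hij (by decide) | skip
  all_goals
    simp only [Fin.zero_eta, Fin.mk_one, Fin.reduceFinMk, Phi0Contract_e]
    ring

theorem eq_add_Phi0Contract {w : Fin 8 → Fin 8 → ℝ}
    (h : ∀ i j, i < j → Phi0Contract w (e i) (e j) = 3 * w i j) {v : V8} (hv : ∀ j, v j = w 0 j)
    {i j : Fin 8} (hij : i < j) :
    w i j = minor i j (e 0) v + Phi0Contract (fun p q => minor p q (e 0) v) (e i) (e j) := by
  have hm (p q : Fin 8) : minor p q (e 0) v =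
      (if p = 0 then w 0 q else 0) - (if q = 0 then w 0 p else 0) := by
    simp [minor, e_apply, hv]
  have eij := h i j hij
  have e01 := h 0 1 (by decide)
  have e02 := h 0 2 (by decide)
  have e03 := h 0 3 (by decide)
  have e04 := h 0 4 (by decide)
  have e05 := h 0 5 (by decide)
  have e06 := h 0 6 (by decide)
  have e07 := h 0 7 (by decide)
  clear h
  simp only [Phi0Contract_e] at e01 e02 e03 e04 e05 e06 e07
  fin_cases i <;> fin_cases j <;> first | exact absurd hij (by decide) | skip
  all_goals
    simp only [Fin.zero_eta, Fin.mk_one, Fin.reduceFinMk, Phi0Contract_e] at eij ⊢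
    simp [hm]
    try linarith

theorem crossForm7_apply (u v x y : V8) :
    crossForm7 u v ![x, y] =
      inner ℝ u x * inner ℝ v y - inner ℝ u y * inner ℝ v x + Phi0 ![u, v, x, y] := by
  have h : wedgeF u v ![x, y] = inner ℝ u x * inner ℝ v y - inner ℝ u y * inner ℝ v x := by
    refine (Matrix.det_fin_two _).trans ?_
    simp
    ring
  rw [← h, ← iotaPhi_apply]
  rfl

theorem crossForm7_apply_e (u v : V8) (i j : Fin 8) :
    crossForm7 u v ![e i, e j] =
      minor i j u v + Phi0Contract (fun p q => minor p q u v) (e i) (e j) := by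
  rw [crossForm7_apply, Phi0_apply]
  simp [e, minor, EuclideanSpace.inner_single_right]

theorem T_crossForm7 (u v : V8) : T (crossForm7 u v) = (3 : ℝ) • crossForm7 u v := by
  refine alternating_two_ext fun i j hij => ?_
  rw [T_apply_eq_Phi0Contract, AlternatingMap.smul_apply, smul_eq_mul]
  simp only [crossForm7_apply_e]
  exact Phi0Contract_add_Phi0Contract (fun p q => minor p q u v) hij

theorem exists_eq_crossForm7 {ω : AlternatingMap ℝ V8 ℝ (Fin 2)} (h : T ω = (3 : ℝ) • ω) :
    ∃ u v : V8, ω = crossForm7 u v := by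
  refine ⟨e 0, WithLp.toLp 2 fun j => ω ![e 0, e j], alternating_two_ext fun i j hij => ?_⟩
  rw [crossForm7_apply_e]
  refine eq_add_Phi0Contract (w := fun i j => ω ![e i, e j]) (fun p q _ => ?_) (fun _ => rfl) hij
  rw [← T_apply_eq_Phi0Contract, h]
  rfl

/-- **Λ²₇ is the set of cross-product forms:** the 3-eigenspace of `T = ⋆(Φ₀∧·)` is exactly
`{ u♭∧v♭ − ι(u)ι(v)Φ₀ : u, v ∈ ℝ⁸ }`. -/
theorem lambda7_eq_crossForms :
    {ω : AlternatingMap ℝ V8 ℝ (Fin 2) | T ω = (3 : ℝ) • ω} =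
      {ω : AlternatingMap ℝ V8 ℝ (Fin 2) | ∃ u v : V8, ω = crossForm7 u v} := by
  ext ω
  refine ⟨exists_eq_crossForm7, ?_⟩
  rintro ⟨u, v, rfl⟩
  exact T_crossForm7 u v
end
end

section
/- The cross product maps ξ × ξ^⊥ into E_ξ: for every u ∈ ξ = span{e₁,e₂,e₃,e₄} and every w ∈ ℝ⁸ orthogonal to ξ, the alternating 2-form u×w vanishes when restricted to ξ, i.e. (u×w)(x,y) = 0 for all x, y ∈ ξ. (Equivalently, Φ₀(u,w,x,y) = 0 whenever u,x,y ∈ ξ and w ⊥ ξ, so u×w lies in the subspace E_ξ = {ω ∈ Λ²₇ : ω|_ξ = 0}.) -/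
open scoped BigOperators RealInnerProductSpace

noncomputable section

/-- The cross product `u×v = ¼(u♭∧v♭ − ι(u)ι(v)Φ₀)`, explicitly
`(u×v)(x,y) = ¼(⟨u,x⟩⟨v,y⟩ − ⟨u,y⟩⟨v,x⟩ + Φ₀(u,v,x,y))`. -/
def cross (u v : V8) : AlternatingMap ℝ V8 ℝ (Fin 2) :=
  ((4 : ℝ)⁻¹) • (wedgeF u v + iotaPhi u v)

/-- The Cayley plane ξ = span{e₁,e₂,e₃,e₄}. -/
def xi : Submodule ℝ V8 := Submodule.span ℝ {e 0, e 1, e 2, e 3}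

/-- Vectors of `ξ` have vanishing last four coordinates. -/
theorem apply_eq_zero_of_mem_xi {v : V8} (hv : v ∈ xi) :
    v 4 = 0 ∧ v 5 = 0 ∧ v 6 = 0 ∧ v 7 = 0 := by
  induction hv using Submodule.span_induction with
  | mem z hz =>
    simp only [Set.mem_insert_iff, Set.mem_singleton_iff] at hz
    rcases hz with rfl | rfl | rfl | rfl <;> simp [e]
  | zero => simp
  | add a b _ _ ha hb => simp [ha, hb]
  | smul c a _ ha => simp [ha]

/-- Vectors orthogonal to `ξ` have vanishing first four coordinates. -/
theorem apply_eq_zero_of_mem_xi_orthogonal {w : V8} (hw : w ∈ xiᗮ) :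
    w 0 = 0 ∧ w 1 = 0 ∧ w 2 = 0 ∧ w 3 = 0 := by
  have coord (i : Fin 8) (hi : e i ∈ xi) : w i = 0 := by
    have h := (Submodule.mem_orthogonal xi w).1 hw (e i) hi
    rw [e, EuclideanSpace.inner_single_left] at h
    simpa using h
  refine ⟨coord 0 ?_, coord 1 ?_, coord 2 ?_, coord 3 ?_⟩ <;>
    exact Submodule.subset_span (by simp)

theorem wedgeF_apply (u v x y : V8) :
    wedgeF u v ![x, y] = ⟪u, x⟫ * ⟪v, y⟫ - ⟪u, y⟫ * ⟪v, x⟫ := by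
  change Matrix.det (Matrix.of fun a b : Fin 2 =>
    (![innerSL ℝ u, innerSL ℝ v] b : V8 →L[ℝ] ℝ) (![x, y] a)) = _
  simp [Matrix.det_fin_two]
  ring

theorem dxQ_eq_det (i j k l : Fin 8) (m : Fin 4 → V8) :
    dxQ i j k l m = Matrix.det (Matrix.of fun a b : Fin 4 => m a (![i, j, k, l] b)) :=
  rfl

/-- Laplace expansion of `dxQ` along the second vector. -/
theorem dxQ_apply_s6 (i j k l : Fin 8) (u w x y : V8) :
    dxQ i j k l ![u, w, x, y] =
      -w i * (u j * (x k * y l - x l * y k) - u k * (x j * y l - x l * y j)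
        + u l * (x j * y k - x k * y j))
      + w j * (u i * (x k * y l - x l * y k) - u k * (x i * y l - x l * y i)
        + u l * (x i * y k - x k * y i))
      - w k * (u i * (x j * y l - x l * y j) - u j * (x i * y l - x l * y i)
        + u l * (x i * y j - x j * y i))
      + w l * (u i * (x j * y k - x k * y j) - u j * (x i * y k - x k * y i)
        + u k * (x i * y j - x j * y i)) := by
  have h : dxQ i j k l ![u, w, x, y] =
      Matrix.det !![u i, u j, u k, u l; w i, w j, w k, w l;
        x i, x j, x k, x l; y i, y j, y k, y l] := by
    rw [dxQ_eq_det]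
    congr 1
    ext a b
    fin_cases a <;> fin_cases b <;> rfl
  rw [h, Matrix.det_succ_row _ 1]
  simp [Fin.sum_univ_succ, Matrix.det_fin_three, Fin.succAbove]
  ring

theorem Phi0_apply_eq_zero {u w x y : V8} (hu : u ∈ xi) (hw : w ∈ xiᗮ)
    (hx : x ∈ xi) (hy : y ∈ xi) : Phi0 ![u, w, x, y] = 0 := by
  obtain ⟨hu4, hu5, hu6, hu7⟩ := apply_eq_zero_of_mem_xi hu
  obtain ⟨hx4, hx5, hx6, hx7⟩ := apply_eq_zero_of_mem_xi hx
  obtain ⟨hy4, hy5, hy6, hy7⟩ := apply_eq_zero_of_mem_xi hy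
  obtain ⟨hw0, hw1, hw2, hw3⟩ := apply_eq_zero_of_mem_xi_orthogonal hw
  simp [Phi0, dxQ_apply_s6, hu4, hu5, hu6, hu7, hx4, hx5, hx6, hx7, hy4, hy5, hy6, hy7,
    hw0, hw1, hw2, hw3]

/-- **The cross product maps ξ × ξ^⊥ into E_ξ:** for `u ∈ ξ` and `w ⊥ ξ`, the 2-form `u×w`
vanishes on ξ, i.e. `(u×w)(x,y) = 0` for all `x, y ∈ ξ`. -/
theorem cross_mem_E (u w x y : V8) (hu : u ∈ xi) (hw : w ∈ xiᗮ)
    (hx : x ∈ xi) (hy : y ∈ xi) :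
    cross u w ![x, y] = 0 := by
  have hwx : ⟪w, x⟫ = 0 := Submodule.inner_left_of_mem_orthogonal hx hw
  have hwy : ⟪w, y⟫ = 0 := Submodule.inner_left_of_mem_orthogonal hy hw
  have hPhi : iotaPhi u w ![x, y] = 0 := by
    rw [iotaPhi, AlternatingMap.curryLeft_apply_apply, AlternatingMap.curryLeft_apply_apply]
    exact Phi0_apply_eq_zero hu hw hx hy
  simp [cross, wedgeF_apply, hwx, hwy, hPhi]
end
end
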